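/- arXiv:2003.01918 — 8 statements merged into one kernel-verified Lean document; each statement's English description precedes it below -/
import Mathlib

section
/- For every natural number n, the number of closed Deutsch paths of length n equals T(n,n) − T(n,n−1), where T(n,k) denotes the trinomial coefficient, i.e. the coefficient of X^k in the polynomial (1+X+X²)^n over ℤ (with T(n,k) = 0 for k < 0). -/
/-- A Deutsch path of length `n`: a sequence `a 0, …, a n` of nonnegative integers with
`a 0 = 0` such that each step is either an up-step of one unit or a down-step of
arbitrary positive size. -/
def DeutschPath (n : ℕ) (a : Fin (n + 1) → ℕ) : Prop :=
  a 0 = 0 ∧ ∀ j : Fin n, a j.succ = a j.castSucc + 1 ∨ a j.succ < a j.castSucc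

/-- The trinomial coefficient `T(n, k)`: the coefficient of `X^k` in `(1 + X + X²)^n`
over `ℤ`, with `T(n, k) = 0` for `k < 0`. -/
noncomputable def trinomial (n : ℕ) (k : ℤ) : ℤ :=
  if k < 0 then 0
  else ((1 + Polynomial.X + Polynomial.X ^ 2 : Polynomial ℤ) ^ n).coeff k.toNat

/-- The Deutsch-type paths of length `n` that start at height `k` and end at height `0`. -/
def pathsToZero : (n : ℕ) → ℕ → Finset (Fin (n + 1) → ℕ)
  | 0, k => if k = 0 then {fun _ => 0} else ∅
  | n + 1, k => (insert (k + 1) (Finset.range k)).biUnion fun m =>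
      (pathsToZero n m).image (Fin.cons (α := fun _ => ℕ) k)

theorem mem_pathsToZero {n k : ℕ} {a : Fin (n + 1) → ℕ} :
    a ∈ pathsToZero n k ↔
      (a 0 = k ∧ ∀ j : Fin n, a j.succ = a j.castSucc + 1 ∨ a j.succ < a j.castSucc) ∧
        a (Fin.last n) = 0 := by
  induction n generalizing k with
  | zero =>
    by_cases hk : k = 0
    · simp [pathsToZero, hk, funext_iff]
    · simp only [pathsToZero, hk, if_false, Finset.notMem_empty, false_iff]
      rintro ⟨⟨h, -⟩, h'⟩
      exact hk (h ▸ h')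
  | succ n ih =>
    simp only [pathsToZero, Finset.mem_biUnion, Finset.mem_insert, Finset.mem_range,
      Finset.mem_image, ih]
    constructor
    · rintro ⟨m, hm, b, ⟨⟨hb0, hb⟩, hlast⟩, rfl⟩
      refine ⟨⟨rfl, fun j => ?_⟩, by rw [← Fin.succ_last, Fin.cons_succ, hlast]⟩
      induction j using Fin.cases with
      | zero => simpa [hb0] using hm
      | succ j => simpa [← Fin.succ_castSucc] using hb j
    · rintro ⟨⟨h0, hstep⟩, hlast⟩
      refine ⟨a 1, by simpa [h0] using hstep 0, Fin.tail a, ⟨⟨rfl, fun j => ?_⟩, ?_⟩, ?_⟩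
      · simpa [Fin.tail, ← Fin.succ_castSucc] using hstep j.succ
      · simpa [Fin.tail] using hlast
      · rw [← h0, Fin.cons_self_tail]

theorem card_pathsToZero_succ (n k : ℕ) :
    (pathsToZero (n + 1) k).card =
      (pathsToZero n (k + 1)).card + ∑ m ∈ Finset.range k, (pathsToZero n m).card := by
  rw [pathsToZero, Finset.card_biUnion, Finset.sum_insert (by simp)]
  · simp only [Finset.card_image_of_injective _ (Fin.cons_right_injective (α := fun _ => ℕ) k)]
  · intro x _ y _ hxy
    rw [Function.onFun, Finset.disjoint_left]
    simp only [Finset.mem_image, not_exists, not_and]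
    rintro _ ⟨b, hb, rfl⟩ c hc hcb
    obtain rfl := Fin.cons_right_injective (α := fun _ => ℕ) k hcb
    exact hxy ((mem_pathsToZero.1 hb).1.1.symm.trans (mem_pathsToZero.1 hc).1.1)

/-- The function `k ↦ ∑ j, b j * k.choose j` with Newton coefficients `b`. -/
def newtonSeries : (ℕ → ℤ) → ℕ → ℤ
  | b, 0 => b 0
  | b, k + 1 => newtonSeries b k + newtonSeries (fun j => b (j + 1)) k

theorem newtonSeries_add (b c : ℕ → ℤ) (k : ℕ) :
    newtonSeries (fun j => b j + c j) k = newtonSeries b k + newtonSeries c k := by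
  induction k generalizing b c with
  | zero => rfl
  | succ k ih => simp only [newtonSeries, ih]; ring

theorem newtonSeries_neg (b : ℕ → ℤ) (k : ℕ) :
    newtonSeries (fun j => -b j) k = -newtonSeries b k := by
  induction k generalizing b with
  | zero => rfl
  | succ k ih => simp only [newtonSeries, ih]; ring

theorem sum_range_newtonSeries_shift (b : ℕ → ℤ) (hb : b 0 = 0) (k : ℕ) :
    ∑ m ∈ Finset.range k, newtonSeries (fun j => b (j + 1)) m = newtonSeries b k := by
  induction k with
  | zero => simp [newtonSeries, hb]
  | succ k ih => rw [Finset.sum_range_succ, ih, newtonSeries]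

theorem trinomial_of_neg {n : ℕ} {k : ℤ} (hk : k < 0) : trinomial n k = 0 := if_pos hk

theorem trinomial_natCast (n k : ℕ) :
    trinomial n k = ((1 + Polynomial.X + Polynomial.X ^ 2 : Polynomial ℤ) ^ n).coeff k := by
  simp [trinomial]

theorem trinomial_zero (k : ℤ) : trinomial 0 k = if k = 0 then 1 else 0 := by
  obtain hk | hk := lt_or_ge k 0
  · rw [trinomial_of_neg hk, if_neg hk.ne]
  · lift k to ℕ using hk
    simp [trinomial_natCast, Polynomial.coeff_one]

theorem trinomial_succ (n : ℕ) (k : ℤ) :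
    trinomial (n + 1) k = trinomial n k + trinomial n (k - 1) + trinomial n (k - 2) := by
  obtain hk | hk := lt_or_ge k 0
  · simp [trinomial_of_neg, hk, show k - 1 < 0 by lia, show k - 2 < 0 by lia]
  · lift k to ℕ using hk
    have hmul (p : Polynomial ℤ) : p * (1 + Polynomial.X + Polynomial.X ^ 2) =
        p + p * Polynomial.X + p * Polynomial.X * Polynomial.X := by ring
    rw [trinomial_natCast, pow_succ, hmul]
    match k with
    | 0 => simp [trinomial]
    | 1 => simp [trinomial, Polynomial.coeff_mul_X]
    | k + 2 =>
      rw [show ((k + 2 : ℕ) : ℤ) - 1 = (k + 1 : ℕ) by lia,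
        show ((k + 2 : ℕ) : ℤ) - 2 = k by lia]
      simp only [trinomial_natCast, Polynomial.coeff_add, Polynomial.coeff_mul_X]

/-- The trinomial coefficients indexed by their distance from the centre. -/
noncomputable def centeredTrinomial (n : ℕ) (j : ℤ) : ℤ := trinomial n (n + j)

theorem centeredTrinomial_zero (j : ℤ) : centeredTrinomial 0 j = if j = 0 then 1 else 0 := by
  simp [centeredTrinomial, trinomial_zero]

theorem centeredTrinomial_succ (n : ℕ) (j : ℤ) :
    centeredTrinomial (n + 1) j =
      centeredTrinomial n (j + 1) + centeredTrinomial n j + centeredTrinomial n (j - 1) := by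
  simp only [centeredTrinomial, trinomial_succ]
  rw [show ((n + 1 : ℕ) : ℤ) + j = n + (j + 1) by lia,
    show (n : ℤ) + (j + 1) - 1 = n + j by ring,
    show (n : ℤ) + (j + 1) - 2 = n + (j - 1) by ring]

theorem centeredTrinomial_neg (n : ℕ) (j : ℤ) :
    centeredTrinomial n (-j) = centeredTrinomial n j := by
  induction n generalizing j with
  | zero => simp [centeredTrinomial_zero]
  | succ n ih =>
    rw [centeredTrinomial_succ, centeredTrinomial_succ, ← ih (j + 1), ← ih (j - 1), ← ih j,
      show -j + 1 = -(j - 1) by ring, show -j - 1 = -(j + 1) by ring]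
    ring

/-- `deutschCoeff n (j + 1)` is the `j`-th Newton coefficient of the function counting the paths
of length `n` from height `k` to height `0`. -/
noncomputable def deutschCoeff (n : ℕ) : ℕ → ℤ
  | 0 => 0
  | j + 1 => centeredTrinomial n j - centeredTrinomial n (j + 1) - deutschCoeff n j

theorem deutschCoeff_succ (n j : ℕ) :
    deutschCoeff (n + 1) (j + 1) =
      deutschCoeff n (j + 1) + deutschCoeff n (j + 2) + deutschCoeff n j := by
  induction j with
  | zero =>
    have h := centeredTrinomial_neg n 1
    simp [deutschCoeff, centeredTrinomial_succ, h]
    ring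
  | succ j ih =>
    rw [deutschCoeff, ih]
    simp only [deutschCoeff, centeredTrinomial_succ]
    push_cast
    ring_nf

theorem newtonSeries_deutschCoeff_zero (k : ℕ) :
    newtonSeries (fun j => deutschCoeff 0 (j + 1)) k = if k = 0 then 1 else 0 := by
  cases k with
  | zero => simp [newtonSeries, deutschCoeff, centeredTrinomial_zero]
  | succ k =>
    have h (j : ℕ) : deutschCoeff 0 (j + 1 + 1) = -deutschCoeff 0 (j + 1) := by
      rw [deutschCoeff, centeredTrinomial_zero, centeredTrinomial_zero, if_neg (by lia),
        if_neg (by lia)]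
      ring
    simp only [newtonSeries, h, newtonSeries_neg]
    simp

theorem card_pathsToZero (n k : ℕ) :
    ((pathsToZero n k).card : ℤ) = newtonSeries (fun j => deutschCoeff n (j + 1)) k := by
  induction n generalizing k with
  | zero =>
    rw [newtonSeries_deutschCoeff_zero, pathsToZero]
    split_ifs <;> simp
  | succ n ih =>
    rw [card_pathsToZero_succ]
    push_cast
    simp only [ih, deutschCoeff_succ, newtonSeries_add]
    rw [sum_range_newtonSeries_shift (deutschCoeff n) rfl, newtonSeries]

theorem closed_deutsch_count (n : ℕ) :
    ({a : Fin (n + 1) → ℕ | DeutschPath n a ∧ a (Fin.last n) = 0}.ncard : ℤ) =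
      trinomial n n - trinomial n ((n : ℤ) - 1) := by
  have hset : {a : Fin (n + 1) → ℕ | DeutschPath n a ∧ a (Fin.last n) = 0} =
      pathsToZero n 0 := by
    ext a
    rw [Finset.mem_coe, mem_pathsToZero]
    rfl
  rw [hset, Set.ncard_coe_finset, card_pathsToZero]
  have h := centeredTrinomial_neg n 1
  simp only [centeredTrinomial, ← sub_eq_add_neg] at h
  simp [newtonSeries, deutschCoeff, centeredTrinomial, h]
end

section
/- For every natural number n, the number of open Deutsch paths of length n equals the number of Motzkin paths of length n. -/
/-- A Motzkin path of length `n`: `b 0 = b n = 0` and each step changes the value by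
`−1`, `0`, or `+1`. -/
def MotzkinPath (n : ℕ) (b : Fin (n + 1) → ℕ) : Prop :=
  b 0 = 0 ∧ b (Fin.last n) = 0 ∧
    ∀ j : Fin n,
      b j.succ = b j.castSucc + 1 ∨ b j.succ = b j.castSucc ∨ b j.castSucc = b j.succ + 1

/-- The sequences of `n` steps that start at height `k`, move from any height `h` to a height in
`N h`, and end at a height in `E`. -/
def pathsFrom (N : ℕ → Finset ℕ) (E : Set ℕ) [DecidablePred (· ∈ E)] :
    (n : ℕ) → ℕ → Finset (Fin (n + 1) → ℕ)
  | 0, k => if k ∈ E then {fun _ => k} else ∅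
  | n + 1, k => (N k).biUnion fun l => (pathsFrom N E n l).image (Fin.cons k : _ → Fin (n + 2) → ℕ)

theorem mem_pathsFrom (N : ℕ → Finset ℕ) (E : Set ℕ) [DecidablePred (· ∈ E)] (n k : ℕ)
    (a : Fin (n + 1) → ℕ) :
    a ∈ pathsFrom N E n k ↔
      a 0 = k ∧ a (Fin.last n) ∈ E ∧ ∀ j : Fin n, a j.succ ∈ N (a j.castSucc) := by
  induction n generalizing k with
  | zero =>
    rw [pathsFrom]
    have key : a = (fun _ => k) ↔ a 0 = k := by
      rw [funext_iff, Fin.forall_fin_one]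
    split_ifs with hk
    · rw [Finset.mem_singleton, key]
      constructor
      · intro h
        exact ⟨h, by simpa [h] using hk, fun j => j.elim0⟩
      · exact fun h => h.1
    · simp only [Finset.notMem_empty, false_iff]
      rintro ⟨rfl, h, -⟩
      exact hk (by simpa using h)
  | succ n ih =>
    simp only [pathsFrom, Finset.mem_biUnion, Finset.mem_image]
    constructor
    · rintro ⟨l, hl, b, hb, rfl⟩
      obtain ⟨h0, hE, hs⟩ := (ih l b).1 hb
      refine ⟨rfl, ?_, ?_⟩
      · rw [← Fin.succ_last, Fin.cons_succ]
        exact hE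
      · intro j
        refine Fin.cases ?_ (fun i => ?_) j
        · simpa [h0] using hl
        · rw [Fin.cons_succ, ← Fin.succ_castSucc, Fin.cons_succ]
          exact hs i
    · rintro ⟨rfl, hE, hs⟩
      refine ⟨a 1, by simpa using hs 0, Fin.tail a, (ih _ _).2 ⟨rfl, ?_, ?_⟩,
        Fin.cons_self_tail a⟩
      · simpa [Fin.tail] using hE
      · intro j
        simpa [Fin.tail] using hs j.succ

theorem card_pathsFrom_succ (N : ℕ → Finset ℕ) (E : Set ℕ) [DecidablePred (· ∈ E)] (n k : ℕ) :
    (pathsFrom N E (n + 1) k).card = ∑ l ∈ N k, (pathsFrom N E n l).card := by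
  have hinj := Fin.cons_right_injective (α := fun _ : Fin (n + 2) => ℕ) k
  rw [pathsFrom, Finset.card_biUnion]
  · exact Finset.sum_congr rfl fun l _ => Finset.card_image_of_injective _ hinj
  · intro l _ l' _ hne
    rw [Function.onFun, Finset.disjoint_image hinj, Finset.disjoint_left]
    intro b hb hb'
    exact hne (((mem_pathsFrom N E n l b).1 hb).1.symm.trans ((mem_pathsFrom N E n l' b).1 hb').1)

/-- The heights reachable from `h` by one Deutsch step. -/
def deutschSteps (h : ℕ) : Finset ℕ := insert (h + 1) (Finset.range h)

/-- The heights reachable from `h` by one Motzkin step. -/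
def motzkinSteps (h : ℕ) : Finset ℕ := Finset.Icc (h - 1) (h + 1)

theorem sum_deutschSteps (f : ℕ → ℕ) (h : ℕ) :
    ∑ l ∈ deutschSteps h, f l = f (h + 1) + ∑ l ∈ Finset.range h, f l :=
  Finset.sum_insert (by simp)

theorem sum_motzkinSteps_zero (f : ℕ → ℕ) : ∑ l ∈ motzkinSteps 0, f l = f 0 + f 1 := by
  rw [show motzkinSteps 0 = {0, 1} from rfl]
  simp

theorem sum_motzkinSteps_succ (f : ℕ → ℕ) (h : ℕ) :
    ∑ l ∈ motzkinSteps (h + 1), f l = f h + f (h + 1) + f (h + 2) := by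
  have : motzkinSteps (h + 1) = {h, h + 1, h + 2} := by
    ext x
    simp only [motzkinSteps, Finset.mem_Icc, Finset.mem_insert, Finset.mem_singleton]
    omega
  rw [this, Finset.sum_insert (by simp), Finset.sum_insert (by simp), Finset.sum_singleton,
    add_assoc]

/-- The binomial transform of a sequence. -/
def binomialTransform (f : ℕ → ℕ) (h : ℕ) : ℕ := ∑ k ∈ Finset.range (h + 1), h.choose k * f k

theorem binomialTransform_succ (f : ℕ → ℕ) (h : ℕ) :
    binomialTransform f (h + 1) =
      binomialTransform f h + binomialTransform (fun k => f (k + 1)) h := by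
  simp only [binomialTransform]
  rw [Finset.sum_range_succ' _ (h + 1)]
  simp only [Nat.choose_succ_succ, add_mul, Finset.sum_add_distrib]
  rw [Finset.sum_range_succ (fun k => h.choose (k + 1) * f (k + 1)),
    Finset.sum_range_succ' (fun k => h.choose k * f k) h]
  simp
  ring

/-- The binomial transform intertwines summation over Motzkin steps and over Deutsch steps. -/
theorem binomialTransform_sum_motzkinSteps (f : ℕ → ℕ) (h : ℕ) :
    binomialTransform (fun k => ∑ l ∈ motzkinSteps k, f l) h =
      ∑ l ∈ deutschSteps h, binomialTransform f l := by
  rw [sum_deutschSteps]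
  induction h with
  | zero =>
    rw [binomialTransform_succ]
    simp [binomialTransform, sum_motzkinSteps_zero]
  | succ h ih =>
    rw [binomialTransform_succ, ih, Finset.sum_range_succ]
    simp only [sum_motzkinSteps_succ]
    have hadd : binomialTransform (fun k => f k + f (k + 1) + f (k + 2)) h =
        binomialTransform f h + binomialTransform (fun k => f (k + 1)) h +
          binomialTransform (fun k => f (k + 2)) h := by
      simp only [binomialTransform, mul_add, Finset.sum_add_distrib]
    rw [hadd, binomialTransform_succ f (h + 1), binomialTransform_succ f h,
      binomialTransform_succ (fun k => f (k + 1)) h]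
    ring

theorem card_deutsch_pathsFrom (n h : ℕ) :
    (pathsFrom deutschSteps Set.univ n h).card =
      binomialTransform (fun k => (pathsFrom motzkinSteps {0} n k).card) h := by
  induction n generalizing h with
  | zero =>
    rw [binomialTransform, Finset.sum_eq_single 0]
    · simp [pathsFrom]
    · intro k _ hk
      simp [pathsFrom, hk]
    · simp
  | succ n ih =>
    simp only [card_pathsFrom_succ, binomialTransform_sum_motzkinSteps, ih]

theorem open_deutsch_eq_motzkin (n : ℕ) :
    {a : Fin (n + 1) → ℕ | DeutschPath n a}.ncard =
      {b : Fin (n + 1) → ℕ | MotzkinPath n b}.ncard := by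
  have hD : {a : Fin (n + 1) → ℕ | DeutschPath n a} = pathsFrom deutschSteps Set.univ n 0 := by
    ext a
    simp [mem_pathsFrom, DeutschPath, deutschSteps]
  have hM : {b : Fin (n + 1) → ℕ | MotzkinPath n b} = pathsFrom motzkinSteps {0} n 0 := by
    ext b
    simp only [Set.mem_ofPred_eq, Finset.mem_coe, mem_pathsFrom, MotzkinPath, motzkinSteps,
      Finset.mem_Icc, Set.mem_singleton_iff]
    refine and_congr_right fun _ => and_congr_right fun _ => forall_congr' fun j => ?_
    omega
  rw [hD, hM, Set.ncard_coe_finset, Set.ncard_coe_finset, card_deutsch_pathsFrom]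
  simp [binomialTransform]
end

section
/- For every natural number n, the number of Motzkin paths of length n equals T(n,n) − T(n,n−2), where T(n,k) denotes the trinomial coefficient, i.e. the coefficient of X^k in the polynomial (1+X+X²)^n over ℤ (with T(n,k) = 0 for k < 0). -/
theorem trinomial_symm (n : ℕ) (j : ℤ) : trinomial n (n + j) = trinomial n (n - j) := by
  induction n generalizing j with
  | zero => simp [trinomial_zero]
  | succ n ih =>
    rw [trinomial_succ, trinomial_succ]
    push_cast
    have h1 := ih (j + 1)
    have h2 := ih j
    have h3 := ih (j - 1)
    ring_nf at h1 h2 h3 ⊢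
    linarith

/-- The nonnegative paths of length `n` with steps `−1`, `0`, `+1` from height `k` to height `0`. -/
def motzkinPathsFrom (n k : ℕ) : Set (Fin (n + 1) → ℕ) :=
  {b | b 0 = k ∧ b (Fin.last n) = 0 ∧
    ∀ j : Fin n,
      b j.succ = b j.castSucc + 1 ∨ b j.succ = b j.castSucc ∨ b j.castSucc = b j.succ + 1}

theorem motzkinPathsFrom_zero_zero : motzkinPathsFrom 0 0 = {fun _ => 0} := by
  ext b
  simp only [motzkinPathsFrom, Set.mem_ofPred_eq, Set.mem_singleton_iff]
  constructor
  · rintro ⟨h, -, -⟩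
    funext i
    obtain rfl : i = 0 := Fin.fin_one_eq_zero i
    exact h
  · rintro rfl
    simp

theorem motzkinPathsFrom_zero_succ (k : ℕ) : motzkinPathsFrom 0 (k + 1) = ∅ := by
  ext b
  simp only [motzkinPathsFrom, Set.mem_ofPred_eq, Set.mem_empty_iff_false, iff_false]
  rintro ⟨h, h', -⟩
  rw [Fin.last_zero] at h'
  omega

theorem mem_motzkinPathsFrom_succ {n k : ℕ} {b : Fin (n + 2) → ℕ} :
    b ∈ motzkinPathsFrom (n + 1) k ↔
      b 0 = k ∧ ∃ m, (m = k + 1 ∨ m = k ∨ k = m + 1) ∧ Fin.tail b ∈ motzkinPathsFrom n m := by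
  simp only [motzkinPathsFrom, Set.mem_ofPred_eq, Fin.forall_fin_succ (n := n), Fin.tail,
    Fin.succ_last, Fin.castSucc_zero, Fin.castSucc_succ]
  constructor
  · rintro ⟨rfl, hl, h0, hs⟩
    exact ⟨rfl, _, h0, rfl, hl, hs⟩
  · rintro ⟨rfl, m, hm, rfl, hl, hs⟩
    exact ⟨rfl, hl, hm, hs⟩

theorem cons_image_eq {n k : ℕ} (s : Set (Fin (n + 1) → ℕ)) :
    Fin.cons (α := fun _ => ℕ) k '' s = {b | b 0 = k ∧ Fin.tail (α := fun _ => ℕ) b ∈ s} := by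
  ext b
  constructor
  · rintro ⟨c, hc, rfl⟩
    exact ⟨rfl, by rwa [Fin.tail_cons]⟩
  · rintro ⟨rfl, hb⟩
    exact ⟨_, hb, Fin.cons_self_tail b⟩

theorem motzkinPathsFrom_succ_zero (n : ℕ) :
    motzkinPathsFrom (n + 1) 0 =
      Fin.cons (α := fun _ => ℕ) 0 ''
        (motzkinPathsFrom n 1 ∪ motzkinPathsFrom n 0) := by
  ext b
  rw [mem_motzkinPathsFrom_succ, cons_image_eq]
  simp [or_and_right, exists_or]

theorem motzkinPathsFrom_succ_succ (n k : ℕ) :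
    motzkinPathsFrom (n + 1) (k + 1) =
      Fin.cons (α := fun _ => ℕ) (k + 1) ''
        (motzkinPathsFrom n (k + 2) ∪ (motzkinPathsFrom n (k + 1) ∪ motzkinPathsFrom n k)) := by
  ext b
  rw [mem_motzkinPathsFrom_succ, cons_image_eq]
  simp [or_and_right, exists_or]

theorem disjoint_motzkinPathsFrom (n : ℕ) {k l : ℕ} (h : k ≠ l) :
    Disjoint (motzkinPathsFrom n k) (motzkinPathsFrom n l) :=
  Set.disjoint_left.2 fun _ hk hl => h (hk.1.symm.trans hl.1)

theorem finite_motzkinPathsFrom (n k : ℕ) : (motzkinPathsFrom n k).Finite := by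
  induction n generalizing k with
  | zero =>
    cases k with
    | zero => simp [motzkinPathsFrom_zero_zero]
    | succ k => simp [motzkinPathsFrom_zero_succ]
  | succ n ih =>
    cases k with
    | zero =>
      rw [motzkinPathsFrom_succ_zero]
      exact ((ih _).union (ih _)).image _
    | succ k =>
      rw [motzkinPathsFrom_succ_succ]
      exact ((ih _).union ((ih _).union (ih _))).image _

theorem ncard_motzkinPathsFrom (n k : ℕ) :
    ((motzkinPathsFrom n k).ncard : ℤ) = trinomial n (n - k) - trinomial n (n - k - 2) := by
  induction n generalizing k with
  | zero =>
    cases k with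
    | zero => simp [motzkinPathsFrom_zero_zero, trinomial_zero]
    | succ k =>
      rw [motzkinPathsFrom_zero_succ, trinomial_zero, trinomial_zero, if_neg (by omega),
        if_neg (by omega)]
      simp
  | succ n ih =>
    have hfin := finite_motzkinPathsFrom n
    rw [trinomial_succ, trinomial_succ]
    cases k with
    | zero =>
      rw [motzkinPathsFrom_succ_zero, Set.ncard_image_of_injective _ (Fin.cons_right_injective _),
        Set.ncard_union_eq (disjoint_motzkinPathsFrom n (by omega)) (hfin _) (hfin _)]
      have hsymm := trinomial_symm n 1
      push_cast [ih]
      ring_nf at hsymm ⊢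
      linarith
    | succ k =>
      rw [motzkinPathsFrom_succ_succ, Set.ncard_image_of_injective _ (Fin.cons_right_injective _),
        Set.ncard_union_eq
          (Set.disjoint_union_right.2 ⟨disjoint_motzkinPathsFrom n (by omega),
            disjoint_motzkinPathsFrom n (by omega)⟩) (hfin _) ((hfin _).union (hfin _)),
        Set.ncard_union_eq (disjoint_motzkinPathsFrom n (by omega)) (hfin _) (hfin _)]
      push_cast [ih]
      ring_nf

theorem motzkin_count (n : ℕ) :
    ({b : Fin (n + 1) → ℕ | MotzkinPath n b}.ncard : ℤ) =
      trinomial n n - trinomial n ((n : ℤ) - 2) := by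
  have h := ncard_motzkinPathsFrom n 0
  rw [Nat.cast_zero, sub_zero] at h
  exact h
end

section
/- For all natural numbers n and h, the number of closed Deutsch paths of length n whose height is at most h equals the number of closed reversed Deutsch paths of length n whose height is at most h. -/
/-- A reversed Deutsch path of length `n`: `a 0 = 0` and each step is either a down-step
of one unit or an up-step of arbitrary positive size. -/
def RevDeutschPath (n : ℕ) (a : Fin (n + 1) → ℕ) : Prop :=
  a 0 = 0 ∧ ∀ j : Fin n, a j.succ + 1 = a j.castSucc ∨ a j.succ > a j.castSucc

/-- Reading a closed Deutsch path backwards gives a reversed Deutsch path. -/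
theorem DeutschPath.comp_rev {n : ℕ} {a : Fin (n + 1) → ℕ} (ha : DeutschPath n a)
    (hlast : a (Fin.last n) = 0) : RevDeutschPath n (a ∘ Fin.rev) := by
  refine ⟨by simpa using hlast, fun j => ?_⟩
  have := ha.2 j.rev
  simp only [Function.comp_apply, Fin.rev_succ, Fin.rev_castSucc]
  omega

/-- Reading a closed reversed Deutsch path backwards gives a Deutsch path. -/
theorem RevDeutschPath.comp_rev {n : ℕ} {a : Fin (n + 1) → ℕ} (ha : RevDeutschPath n a)
    (hlast : a (Fin.last n) = 0) : DeutschPath n (a ∘ Fin.rev) := by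
  refine ⟨by simpa using hlast, fun j => ?_⟩
  have := ha.2 j.rev
  simp only [Function.comp_apply, Fin.rev_succ, Fin.rev_castSucc]
  omega

theorem bounded_closed_deutsch_eq_bounded_closed_rev (n h : ℕ) :
    {a : Fin (n + 1) → ℕ | DeutschPath n a ∧ a (Fin.last n) = 0 ∧ ∀ j, a j ≤ h}.ncard =
      {a : Fin (n + 1) → ℕ | RevDeutschPath n a ∧ a (Fin.last n) = 0 ∧ ∀ j, a j ≤ h}.ncard := by
  refine Set.ncard_congr (fun a _ => a ∘ Fin.rev) ?_ ?_ ?_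
  · rintro a ⟨ha, hlast, hle⟩
    exact ⟨ha.comp_rev hlast, by simpa using ha.1, fun j => hle j.rev⟩
  · intro a b _ _ hab
    exact Fin.rev_surjective.injective_comp_right hab
  · rintro b ⟨hb, hlast, hle⟩
    refine ⟨b ∘ Fin.rev, ⟨hb.comp_rev hlast, by simpa using hb.1, fun j => hle j.rev⟩, ?_⟩
    ext j
    simp
end

section
/- Let K = ℚ(v) be the field of rational functions in one variable v over ℚ, and set z = v/(1+v+v²) in K. For n ≥ 1 let M_n be the n×n matrix over K (indices 1,…,n) with entries (M_n)_{i,i} = 1, (M_n)_{i,j} = −z whenever j = i−1 or j > i, and (M_n)_{i,j} = 0 whenever j < i−1. Then det(M_n) = (1+v)^{n−1}(1−v^{n+2}) / ((1+v+v²)^n (1−v)). -/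
/-- The rational function `v`. -/
noncomputable def v : RatFunc ℚ := RatFunc.X

/-- `z = v / (1 + v + v²)` in `ℚ(v)`. -/
noncomputable def z : RatFunc ℚ := v / (1 + v + v ^ 2)

/-- The `n × n` Deutsch matrix (1-based indices `i, j`): diagonal entries `1`, entries
`−z` for `j = i − 1` or `j > i`, and `0` for `j < i − 1`.  Here rows and columns are
indexed by `Fin n` (0-based). -/
noncomputable def deutschMatrix (n : ℕ) : Matrix (Fin n) (Fin n) (RatFunc ℚ) :=
  Matrix.of fun i j =>
    if i = j then 1 else if (j : ℕ) + 1 = (i : ℕ) ∨ (i : ℕ) < (j : ℕ) then -z else 0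

/-- The Deutsch matrix of size `n + 1` with its first row replaced by the constant row `-z`. -/
noncomputable def deutschMatrixConstRow (n : ℕ) : Matrix (Fin (n + 1)) (Fin (n + 1)) (RatFunc ℚ) :=
  (deutschMatrix (n + 1)).updateRow 0 fun _ => -z

theorem deutschMatrix_submatrix_zero (n : ℕ) :
    (deutschMatrix (n + 1)).submatrix (Fin.succAbove 0) Fin.succ = deutschMatrix n := by
  ext i j
  simp [deutschMatrix]

theorem deutschMatrix_submatrix_one (n : ℕ) :
    (deutschMatrix (n + 2)).submatrix (Fin.succAbove 1) Fin.succ = deutschMatrixConstRow n := by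
  ext i j
  refine Fin.cases ?_ (fun i => ?_) i
  · simp [deutschMatrix, deutschMatrixConstRow, (Fin.succ_ne_zero j).symm]
  · simp only [Matrix.submatrix_apply, Fin.one_succAbove_succ, deutschMatrixConstRow,
      Matrix.updateRow_ne (Fin.succ_ne_zero i)]
    simp [deutschMatrix]

theorem deutschMatrixConstRow_submatrix_zero (n : ℕ) :
    (deutschMatrixConstRow n).submatrix (Fin.succAbove 0) Fin.succ = deutschMatrix n := by
  rw [← deutschMatrix_submatrix_zero n]
  ext i j
  simp [deutschMatrixConstRow]

theorem deutschMatrixConstRow_submatrix_one (n : ℕ) :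
    (deutschMatrixConstRow (n + 1)).submatrix (Fin.succAbove 1) Fin.succ =
      deutschMatrixConstRow n := by
  rw [← deutschMatrix_submatrix_one n]
  ext i j
  refine Fin.cases ?_ (fun i => ?_) i
  · simp [deutschMatrix, deutschMatrixConstRow, (Fin.succ_ne_zero j).symm]
  · simp only [Matrix.submatrix_apply, Fin.one_succAbove_succ, deutschMatrixConstRow,
      Matrix.updateRow_ne (Fin.succ_ne_zero i.succ)]

theorem deutschMatrix_det_succ_succ (n : ℕ) :
    (deutschMatrix (n + 2)).det =
      (deutschMatrix (n + 1)).det + z * (deutschMatrixConstRow n).det := by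
  have h : ∀ i : Fin n, deutschMatrix (n + 2) i.succ.succ 0 = 0 := fun i => by
    simp [deutschMatrix]
  rw [Matrix.det_succ_column_zero, Fin.sum_univ_succ, Fin.sum_univ_succ, Fin.succ_zero_eq_one,
    deutschMatrix_submatrix_zero, deutschMatrix_submatrix_one]
  simp only [h]
  simp [deutschMatrix]

theorem deutschMatrixConstRow_det_succ (n : ℕ) :
    (deutschMatrixConstRow (n + 1)).det =
      -z * (deutschMatrix (n + 1)).det + z * (deutschMatrixConstRow n).det := by
  have h : ∀ i : Fin n, deutschMatrixConstRow (n + 1) i.succ.succ 0 = 0 := fun i => by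
    simp [deutschMatrixConstRow, deutschMatrix]
  rw [Matrix.det_succ_column_zero, Fin.sum_univ_succ, Fin.sum_univ_succ, Fin.succ_zero_eq_one,
    deutschMatrixConstRow_submatrix_zero, deutschMatrixConstRow_submatrix_one]
  simp only [h]
  simp [deutschMatrixConstRow, deutschMatrix]

theorem one_sub_v_ne_zero : 1 - v ≠ 0 := by
  intro h
  have h' : algebraMap (Polynomial ℚ) (RatFunc ℚ) (1 - Polynomial.X) = 0 := by
    simpa [v] using h
  have h0 := (map_eq_zero_iff _ (RatFunc.algebraMap_injective ℚ)).1 h'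
  simpa using congrArg (Polynomial.eval 0) h0

theorem one_add_v_add_v_sq_ne_zero : 1 + v + v ^ 2 ≠ 0 := by
  intro h
  have h' : algebraMap (Polynomial ℚ) (RatFunc ℚ) (1 + Polynomial.X + Polynomial.X ^ 2) = 0 := by
    simpa [v] using h
  have h0 := (map_eq_zero_iff _ (RatFunc.algebraMap_injective ℚ)).1 h'
  simpa using congrArg (Polynomial.eval 0) h0

theorem deutschMatrix_det_and_deutschMatrixConstRow_det (n : ℕ) :
    (deutschMatrix (n + 1)).det =
        (1 + v) ^ n * (1 - v ^ (n + 3)) / ((1 + v + v ^ 2) ^ (n + 1) * (1 - v)) ∧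
      (deutschMatrixConstRow n).det =
        -((1 + v) ^ n * v * (1 - v ^ (n + 1))) / ((1 + v + v ^ 2) ^ (n + 1) * (1 - v)) := by
  have h1 := one_sub_v_ne_zero
  have h2 := one_add_v_add_v_sq_ne_zero
  induction n with
  | zero =>
    have hd : (deutschMatrix (0 + 1)).det = 1 := by simp [deutschMatrix]
    have he : (deutschMatrixConstRow 0).det = -z := by simp [deutschMatrixConstRow]
    rw [hd, he, z]
    constructor <;>
    · field_simp
      ring
  | succ n ih =>
    rw [deutschMatrix_det_succ_succ, deutschMatrixConstRow_det_succ, ih.1, ih.2, z]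
    constructor <;>
    · field_simp
      ring

theorem deutsch_det (n : ℕ) (hn : 1 ≤ n) :
    (deutschMatrix n).det =
      (1 + v) ^ (n - 1) * (1 - v ^ (n + 2)) / ((1 + v + v ^ 2) ^ n * (1 - v)) := by
  obtain ⟨n, rfl⟩ := Nat.exists_eq_add_of_le' hn
  exact (deutschMatrix_det_and_deutschMatrixConstRow_det n).1
end

section
/- Let K = ℚ(v) be the field of rational functions in one variable v over ℚ and set z = v/(1+v+v²) in K. For n ≥ 1 define the n×n matrices L and U over K (indices 1,…,n) by: L_{i,i} = 1, L_{i,i−1} = −(v/(1+v))·(1−v^i)/(1−v^{i+1}), and L_{i,j} = 0 otherwise; U_{i,i} = ((1+v)/(1+v+v²))·(1−v^{i+2})/(1−v^{i+1}), U_{i,j} = −v·((1+v)/(1+v+v²))·(1−v^{i})/(1−v^{i+1}) for j > i, and U_{i,j} = 0 for j < i. Then L·U = M_n, where M_n is the n×n Deutsch matrix. -/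
/-- The lower-triangular factor `L` (1-based indices): `L i i = 1`,
`L i (i−1) = −(v/(1+v))·(1−v^i)/(1−v^{i+1})`, other entries `0`.
With 0-based index `i₀`, the 1-based index is `i = i₀ + 1`. -/
noncomputable def Lmat (n : ℕ) : Matrix (Fin n) (Fin n) (RatFunc ℚ) :=
  Matrix.of fun i j =>
    if i = j then 1
    else if (j : ℕ) + 1 = (i : ℕ) then
      -(v / (1 + v)) * ((1 - v ^ ((i : ℕ) + 1)) / (1 - v ^ ((i : ℕ) + 2)))
    else 0

/-- The upper-triangular factor `U` (1-based indices):
`U i i = ((1+v)/(1+v+v²))·(1−v^{i+2})/(1−v^{i+1})`,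
`U i j = −v·((1+v)/(1+v+v²))·(1−v^i)/(1−v^{i+1})` for `j > i`, and `0` for `j < i`.
With 0-based index `i₀`, the 1-based index is `i = i₀ + 1`. -/
noncomputable def Umat (n : ℕ) : Matrix (Fin n) (Fin n) (RatFunc ℚ) :=
  Matrix.of fun i j =>
    if i = j then
      (1 + v) / (1 + v + v ^ 2) * ((1 - v ^ ((i : ℕ) + 3)) / (1 - v ^ ((i : ℕ) + 2)))
    else if (i : ℕ) < (j : ℕ) then
      -v * ((1 + v) / (1 + v + v ^ 2)) * ((1 - v ^ ((i : ℕ) + 1)) / (1 - v ^ ((i : ℕ) + 2)))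
    else 0

theorem v_transcendental : Transcendental ℚ v := by
  convert RatFunc.transcendental_X (K := ℚ)
  · exact Subsingleton.elim _ _
  · rfl

theorem one_sub_v_pow_ne_zero (m : ℕ) : 1 - v ^ (m + 1) ≠ 0 := by
  intro h
  refine v_transcendental.pow m.succ_pos ?_
  rw [← sub_eq_zero.mp h]
  exact isAlgebraic_one

theorem one_add_v_ne_zero : 1 + v ≠ 0 := by
  intro h
  apply one_sub_v_pow_ne_zero 1
  linear_combination (1 - v) * h

theorem Lmat_mul_apply_of_val_eq_zero {n : ℕ} (A : Matrix (Fin n) (Fin n) (RatFunc ℚ))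
    {i : Fin n} (hi : (i : ℕ) = 0) (j : Fin n) : (Lmat n * A) i j = A i j := by
  rw [Matrix.mul_apply, Finset.sum_eq_single i]
  · simp [Lmat]
  · intro k _ hk
    simp [Lmat, hk.symm, hi]
  · simp

theorem Lmat_mul_apply_of_val_succ {n : ℕ} (A : Matrix (Fin n) (Fin n) (RatFunc ℚ))
    {i k : Fin n} (hk : (k : ℕ) + 1 = i) (j : Fin n) :
    (Lmat n * A) i j =
      A i j - v / (1 + v) * ((1 - v ^ ((k : ℕ) + 2)) / (1 - v ^ ((k : ℕ) + 3))) * A k j := by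
  have hik : i ≠ k := by
    rintro rfl
    omega
  rw [Matrix.mul_apply, Finset.sum_eq_add i k hik]
  · simp only [Lmat, Matrix.of_apply, if_true, if_neg hik, ← hk]
    ring
  · rintro l - ⟨hli, hlk⟩
    have : (l : ℕ) + 1 ≠ i := fun h => hlk (Fin.ext (by omega))
    simp [Lmat, hli.symm, this]
  · simp
  · simp

theorem deutsch_LU (n : ℕ) (hn : 1 ≤ n) : Lmat n * Umat n = deutschMatrix n := by
  have h₁ := one_add_v_ne_zero
  have h₂ := one_add_v_add_v_sq_ne_zero
  ext i j
  obtain hi | ⟨k, hk⟩ : (i : ℕ) = 0 ∨ ∃ k : Fin n, (k : ℕ) + 1 = i := by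
    rcases Nat.eq_zero_or_pos (i : ℕ) with h | h
    · exact Or.inl h
    · exact Or.inr ⟨⟨i - 1, by omega⟩, by simp only; omega⟩
  · rw [Lmat_mul_apply_of_val_eq_zero _ hi]
    have h₃ := one_sub_v_pow_ne_zero 1
    simp only [Umat, deutschMatrix, z, Matrix.of_apply, Fin.ext_iff, hi]
    norm_num at h₃ ⊢
    split_ifs <;> first | omega | (field_simp; ring)
  · rw [Lmat_mul_apply_of_val_succ _ hk]
    have h₃ := one_sub_v_pow_ne_zero ((k : ℕ) + 1)
    have h₄ := one_sub_v_pow_ne_zero ((k : ℕ) + 2)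
    simp only [Nat.add_assoc, Nat.reduceAdd] at h₃ h₄
    simp only [Umat, deutschMatrix, z, Matrix.of_apply, Fin.ext_iff, ← hk, Nat.add_assoc,
      Nat.reduceAdd]
    split_ifs <;> first | omega | (field_simp; ring)
end

section
/- Let o_n denote the number of open Deutsch paths of length n. Then o_0 = 1 and, for every natural number n, o_{n+1} = o_n + Σ_{k=0}^{n−1} o_k · o_{n−1−k}; that is, the sequence (o_n) satisfies the Motzkin recurrence. -/
/-- The number of open Deutsch paths of length `n`. -/
noncomputable def o (n : ℕ) : ℕ := {a : Fin (n + 1) → ℕ | DeutschPath n a}.ncard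

open Finset PowerSeries

/-- The Deutsch paths of length `n` started at height `h`. -/
def deutschPathsFrom : (n : ℕ) → ℕ → Finset (Fin (n + 1) → ℕ)
  | 0, h => {fun _ => h}
  | n + 1, h => (insert (h + 1) (range h)).biUnion fun k =>
      (deutschPathsFrom n k).image (Fin.cons (α := fun _ => ℕ) h)

theorem mem_deutschPathsFrom {n h : ℕ} {a : Fin (n + 1) → ℕ} :
    a ∈ deutschPathsFrom n h ↔
      a 0 = h ∧ ∀ j : Fin n, a j.succ = a j.castSucc + 1 ∨ a j.succ < a j.castSucc := by
  induction n generalizing h with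
  | zero =>
    simp only [deutschPathsFrom, mem_singleton, IsEmpty.forall_iff, and_true]
    refine ⟨fun e => by rw [e], fun e => funext fun i => ?_⟩
    rw [Subsingleton.elim (α := Fin 1) i 0, e]
  | succ n ih =>
    induction a using Fin.consCases with
    | _ x b =>
      simp only [deutschPathsFrom, mem_biUnion, mem_image, Fin.cons_inj, Fin.forall_fin_succ (n := n),
        mem_insert, mem_range, Fin.cons_succ, Fin.cons_zero, Fin.castSucc_zero, ih,
        ← Fin.succ_castSucc]
      constructor
      · rintro ⟨k, hk, c, ⟨rfl, hc⟩, rfl, rfl⟩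
        exact ⟨rfl, hk, hc⟩
      · rintro ⟨rfl, hk, hb⟩
        exact ⟨b 0, hk, b, ⟨rfl, hb⟩, rfl, rfl⟩

theorem card_deutschPathsFrom_succ (n h : ℕ) :
    #(deutschPathsFrom (n + 1) h) =
      #(deutschPathsFrom n (h + 1)) + ∑ k ∈ range h, #(deutschPathsFrom n k) := by
  rw [deutschPathsFrom, card_biUnion, sum_insert (by simp)]
  · simp only [card_image_of_injective _ (Fin.cons_right_injective (α := fun _ => ℕ) h)]
  · intro k _ l _ hkl
    rw [Function.onFun_apply, disjoint_left]
    simp only [mem_image]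
    rintro _ ⟨b, hb, rfl⟩ ⟨c, hc, e⟩
    obtain rfl := Fin.cons_right_injective (α := fun _ => ℕ) h e
    exact hkl ((mem_deutschPathsFrom.1 hb).1.symm.trans (mem_deutschPathsFrom.1 hc).1)

theorem o_eq_card_deutschPathsFrom (n : ℕ) : o n = #(deutschPathsFrom n 0) := by
  rw [o, ← Set.ncard_coe_finset]
  congr 1
  ext a
  exact mem_deutschPathsFrom.symm

/-- The Motzkin numbers. -/
def motzkin : ℕ → ℕ
  | 0 => 1
  | n + 1 => motzkin n + ∑ k : Fin n, motzkin k * motzkin (n - 1 - k)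

theorem motzkin_succ (n : ℕ) :
    motzkin (n + 1) = motzkin n + ∑ k ∈ range n, motzkin k * motzkin (n - 1 - k) := by
  rw [motzkin, Fin.sum_univ_eq_sum_range (fun k => motzkin k * motzkin (n - 1 - k))]

/-- The generating function of the Motzkin numbers. -/
def motzkinSeries : ℕ⟦X⟧ := PowerSeries.mk motzkin

theorem motzkinSeries_eq :
    motzkinSeries = X * (motzkinSeries * (1 + X * motzkinSeries)) + 1 := by
  ext n
  rcases n with _ | _ | n
  · simp [motzkinSeries, motzkin]
  · simp [motzkinSeries, motzkin, coeff_one, coeff_succ_X_mul]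
  · have e : motzkinSeries * (1 + X * motzkinSeries) =
        motzkinSeries + X * (motzkinSeries * motzkinSeries) := by ring
    rw [e, map_add, coeff_succ_X_mul, map_add, coeff_succ_X_mul, coeff_mul,
      Nat.sum_antidiagonal_eq_sum_range_succ
        (fun i j => coeff i motzkinSeries * coeff j motzkinSeries)]
    simp [motzkinSeries, motzkin_succ (n + 1), coeff_one]

theorem X_mul_sum_motzkinSeries_mul_pow (h : ℕ) :
    X * ∑ j ∈ range h, motzkinSeries * (1 + X * motzkinSeries) ^ j + 1 =
      (1 + X * motzkinSeries) ^ h := by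
  induction h with
  | zero => simp
  | succ h ih =>
    rw [sum_range_succ, mul_add, add_right_comm, ih]
    ring

theorem motzkinSeries_mul_pow_eq (h : ℕ) :
    motzkinSeries * (1 + X * motzkinSeries) ^ h =
      X * (motzkinSeries * (1 + X * motzkinSeries) ^ (h + 1) +
        ∑ j ∈ range h, motzkinSeries * (1 + X * motzkinSeries) ^ j) + 1 := by
  rw [mul_add, add_assoc, X_mul_sum_motzkinSeries_mul_pow]
  calc _ = (X * (motzkinSeries * (1 + X * motzkinSeries)) + 1) *
        (1 + X * motzkinSeries) ^ h := by rw [← motzkinSeries_eq]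
    _ = _ := by ring

theorem card_deutschPathsFrom (n h : ℕ) :
    #(deutschPathsFrom n h) = coeff n (motzkinSeries * (1 + X * motzkinSeries) ^ h) := by
  induction n generalizing h with
  | zero => simp [deutschPathsFrom, motzkinSeries, motzkin]
  | succ n ih =>
    rw [motzkinSeries_mul_pow_eq, map_add, coeff_succ_X_mul, map_add, map_sum,
      card_deutschPathsFrom_succ]
    simp [ih, coeff_one]

theorem o_eq_motzkin (n : ℕ) : o n = motzkin n := by
  simp [o_eq_card_deutschPathsFrom, card_deutschPathsFrom, motzkinSeries]

theorem open_deutsch_motzkin_recurrence :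
    o 0 = 1 ∧ ∀ n : ℕ, o (n + 1) = o n + ∑ k ∈ Finset.range n, o k * o (n - 1 - k) := by
  simp only [o_eq_motzkin]
  exact ⟨by rw [motzkin], motzkin_succ⟩
end

section
/- Let A_n denote the total area of all closed Deutsch paths of length n, i.e. the sum over all closed Deutsch paths a_0, a_1, …, a_n of length n of the quantity a_0 + a_1 + ⋯ + a_n. Then the sequence A_n · 3^{−n} converges to 3/8 as n → ∞. -/
open Filter Real

/-- The total area of all closed Deutsch paths of length `n`: the sum, over all closed
Deutsch paths `a` of length `n`, of `a 0 + a 1 + ⋯ + a n`. -/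
noncomputable def A (n : ℕ) : ℕ :=
  ∑ᶠ a ∈ {a : Fin (n + 1) → ℕ | DeutschPath n a ∧ a (Fin.last n) = 0},
    ∑ j : Fin (n + 1), a j

namespace DeutschPath

/-- The heights `j ≤ n` from which a single step leads to height `k`. -/
def predecessors (n k : ℕ) : Finset ℕ := {j ∈ Finset.range (n + 1) | k = j + 1 ∨ k < j}

/-- The Deutsch paths of length `n` ending at height `k`. -/
def pathsTo : (n : ℕ) → ℕ → Finset (Fin (n + 1) → ℕ)
  | 0, k => if k = 0 then {fun _ => 0} else ∅
  | n + 1, k => (predecessors n k).biUnion fun j =>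
      (pathsTo n j).image fun a => (Fin.snoc a k : Fin (n + 2) → ℕ)

lemma succ_iff {n : ℕ} {a : Fin (n + 2) → ℕ} :
    DeutschPath (n + 1) a ↔ DeutschPath n (fun i => a i.castSucc) ∧
      (a (Fin.last (n + 1)) = a (Fin.last n).castSucc + 1 ∨
        a (Fin.last (n + 1)) < a (Fin.last n).castSucc) := by
  simp only [DeutschPath, Fin.forall_fin_succ' (n := n), Fin.succ_last, Fin.castSucc_zero,
    Fin.succ_castSucc, and_assoc]

lemma last_le {n : ℕ} {a : Fin (n + 1) → ℕ} (h : DeutschPath n a) : a (Fin.last n) ≤ n := by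
  induction n with
  | zero => exact h.1.le
  | succ n ih =>
    obtain ⟨h₁, h₂⟩ := succ_iff.1 h
    have := ih h₁
    grind

lemma mem_pathsTo {n k : ℕ} {a : Fin (n + 1) → ℕ} :
    a ∈ pathsTo n k ↔ DeutschPath n a ∧ a (Fin.last n) = k := by
  induction n generalizing k with
  | zero =>
    have h0 : (a = fun _ => 0) ↔ a 0 = 0 :=
      ⟨fun h => by rw [h], fun h => funext fun i => (congrArg a (Fin.fin_one_eq_zero i)).trans h⟩
    by_cases hk : k = 0
    · simp [pathsTo, DeutschPath, hk, h0]
    · simp only [pathsTo, DeutschPath, hk, if_false, Finset.notMem_empty, false_iff]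
      rintro ⟨⟨h, -⟩, h'⟩
      exact hk (h'.symm.trans h)
  | succ n ih =>
    simp only [pathsTo, predecessors, Finset.mem_biUnion, Finset.mem_filter, Finset.mem_range,
      Finset.mem_image, ih]
    constructor
    · rintro ⟨j, ⟨-, hj⟩, b, ⟨hb, rfl⟩, rfl⟩
      exact ⟨succ_iff.2 ⟨by simpa using hb, by simpa using hj⟩, by simp⟩
    · rintro ⟨h, rfl⟩
      obtain ⟨h₁, h₂⟩ := succ_iff.1 h
      exact ⟨_, ⟨Nat.lt_succ_of_le (last_le h₁), h₂⟩, _, ⟨h₁, rfl⟩, Fin.snoc_init_self a⟩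

lemma sum_pathsTo_succ (n k : ℕ) (φ : (Fin (n + 2) → ℕ) → ℕ) :
    ∑ a ∈ pathsTo (n + 1) k, φ a =
      ∑ j ∈ predecessors n k, ∑ a ∈ pathsTo n j, φ (Fin.snoc a k : Fin (n + 2) → ℕ) := by
  rw [pathsTo, Finset.sum_biUnion]
  · refine Finset.sum_congr rfl fun j _ => Finset.sum_image fun a _ b _ h => ?_
    exact (Fin.snoc_injective2 h).1
  · intro i _ j _ hij
    refine Finset.disjoint_left.2 fun a hi hj => hij ?_
    obtain ⟨b, hb, rfl⟩ := Finset.mem_image.1 hi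
    obtain ⟨c, hc, h⟩ := Finset.mem_image.1 hj
    obtain rfl := (Fin.snoc_injective2 h).1
    rw [← (mem_pathsTo.1 hb).2, ← (mem_pathsTo.1 hc).2]

/-- The number of Deutsch paths of length `n` ending at height `k`. -/
def count (n k : ℕ) : ℕ := ∑ _a ∈ pathsTo n k, 1

/-- The total area of the Deutsch paths of length `n` ending at height `k`. -/
def area (n k : ℕ) : ℕ := ∑ a ∈ pathsTo n k, ∑ j, a j

lemma A_eq_area (n : ℕ) : A n = area n 0 := by
  rw [A, area, ← finsum_mem_coe_finset]
  exact finsum_mem_congr (Set.ext fun _ => mem_pathsTo.symm) fun _ _ => rfl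

lemma pathsTo_eq_empty {n k : ℕ} (h : n < k) : pathsTo n k = ∅ :=
  Finset.eq_empty_of_forall_notMem fun _ ha =>
    h.not_ge ((mem_pathsTo.1 ha).2 ▸ last_le (mem_pathsTo.1 ha).1)

lemma count_eq_zero {n k : ℕ} (h : n < k) : count n k = 0 := by
  simp [count, pathsTo_eq_empty h]

lemma area_eq_zero {n k : ℕ} (h : n < k) : area n k = 0 := by
  simp [area, pathsTo_eq_empty h]

lemma count_zero_zero : count 0 0 = 1 := by simp [count, pathsTo]

lemma area_zero (k : ℕ) : area 0 k = 0 := by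
  by_cases h : k = 0 <;> simp [area, pathsTo, h]

lemma count_succ (n k : ℕ) : count (n + 1) k = ∑ j ∈ predecessors n k, count n j :=
  sum_pathsTo_succ n k fun _ => 1

lemma area_succ (n k : ℕ) :
    area (n + 1) k = (∑ j ∈ predecessors n k, area n j) + k * count (n + 1) k := by
  rw [area, sum_pathsTo_succ, count_succ, Finset.mul_sum, ← Finset.sum_add_distrib]
  refine Finset.sum_congr rfl fun j _ => ?_
  simp [Fin.sum_univ_castSucc, Finset.sum_add_distrib, area, count, mul_comm]

lemma eq_sum_ite {n : ℕ} {φ : ℕ → ℕ} (hφ : ∀ k, n < k → φ k = 0) (k : ℕ) :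
    φ k = ∑ j ∈ Finset.range (n + 1), if j = k then φ j else 0 := by
  rw [Finset.sum_ite_eq']
  have := hφ k
  grind

lemma sum_predecessors_zero {n : ℕ} {φ : ℕ → ℕ} (hφ : ∀ k, n < k → φ k = 0) :
    (∑ j ∈ predecessors n 0, φ j) + φ 0 = (∑ j ∈ predecessors n 1, φ j) + φ 1 := by
  rw [eq_sum_ite hφ 0, eq_sum_ite hφ 1]
  simp only [predecessors, Finset.sum_filter, ← Finset.sum_add_distrib]
  exact Finset.sum_congr rfl fun j _ => by grind

lemma sum_predecessors_succ {n : ℕ} {φ : ℕ → ℕ} (hφ : ∀ k, n < k → φ k = 0) (k : ℕ) :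
    (∑ j ∈ predecessors n (k + 1), φ j) + φ (k + 1) =
      (∑ j ∈ predecessors n (k + 2), φ j) + φ k + φ (k + 2) := by
  rw [eq_sum_ite hφ k, eq_sum_ite hφ (k + 1), eq_sum_ite hφ (k + 2)]
  simp only [predecessors, Finset.sum_filter, ← Finset.sum_add_distrib]
  exact Finset.sum_congr rfl fun j _ => by grind

lemma count_succ_zero (n : ℕ) :
    count (n + 1) 0 + count n 0 = count (n + 1) 1 + count n 1 := by
  simpa only [count_succ] using sum_predecessors_zero fun k => count_eq_zero (n := n) (k := k)

lemma count_succ_succ (n k : ℕ) :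
    count (n + 1) (k + 1) + count n (k + 1) =
      count (n + 1) (k + 2) + count n k + count n (k + 2) := by
  simpa only [count_succ] using
    sum_predecessors_succ (fun k => count_eq_zero (n := n) (k := k)) k

lemma area_succ_zero (n : ℕ) :
    area (n + 1) 0 + area n 0 + count (n + 1) 1 = area (n + 1) 1 + area n 1 := by
  have := sum_predecessors_zero fun k => area_eq_zero (n := n) (k := k)
  rw [area_succ, area_succ]
  linarith

lemma area_succ_succ (n k : ℕ) :
    area (n + 1) (k + 1) + area n (k + 1) + (k + 2) * count (n + 1) (k + 2) =
      area (n + 1) (k + 2) + area n k + area n (k + 2) + (k + 1) * count (n + 1) (k + 1) := by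
  have := sum_predecessors_succ (fun k => area_eq_zero (n := n) (k := k)) k
  rw [area_succ, area_succ n (k + 2)]
  linarith

/-- The discrepancy between the two sides of the linear relation expressing the areas of the
paths of length `n + 1` through those of the paths of length `n`. -/
def defect (n k : ℕ) : ℤ :=
  2 * (area (n + 1) k - 3 * area n k) -
    (k + 1) * (2 * count (n + 1) (k + 2) +
      k * (count (n + 1) k - 3 * count (n + 1) (k + 1) + 2 * count (n + 1) (k + 2)))

lemma defect_eq_zero_of_lt {n k : ℕ} (h : n + 1 < k) : defect n k = 0 := by
  simp [defect, area_eq_zero h, area_eq_zero (show n < k by omega), count_eq_zero h,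
    count_eq_zero (show n + 1 < k + 1 by omega), count_eq_zero (show n + 1 < k + 2 by omega)]

lemma defect_zero (k : ℕ) : defect 0 k = 0 := by
  rcases lt_or_ge 1 k with h | h
  · exact defect_eq_zero_of_lt h
  · have h0 : predecessors 0 0 = ∅ := by decide
    have h1 : predecessors 0 1 = {0} := by decide
    interval_cases k <;>
      simp [defect, area_succ, area_zero, count_eq_zero, count_succ, h0, h1, count_zero_zero]

lemma defect_succ_zero (n : ℕ) :
    defect (n + 1) 0 + defect n 0 = defect (n + 1) 1 + defect n 1 := by
  have h1 := area_succ_zero n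
  have h2 := area_succ_zero (n + 1)
  have h3 := count_succ_zero n
  have h4 := count_succ_zero (n + 1)
  have h5 := count_succ_succ n 0
  have h6 := count_succ_succ (n + 1) 0
  have h7 := count_succ_succ (n + 1) 1
  simp only [defect]
  push_cast
  zify at h1 h2 h3 h4 h5 h6 h7
  norm_num at *
  linarith

lemma defect_succ_succ (n k : ℕ) :
    defect (n + 1) (k + 1) + defect n (k + 1) =
      defect (n + 1) (k + 2) + defect n k + defect n (k + 2) := by
  have h1 := area_succ_succ n k
  have h2 := area_succ_succ (n + 1) k
  have h3 := count_succ_succ (n + 1) k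
  have h4 := count_succ_succ (n + 1) (k + 1)
  have h5 := count_succ_succ (n + 1) (k + 2)
  simp only [defect]
  zify at h1 h2 h3 h4 h5
  push_cast
  linear_combination 2 * h2 - 6 * h1 - (k + 1) * k * h3 +
    (k + 1) * (3 * k + 8) * h4 - 2 * (k + 3) ^ 2 * h5

lemma defect_eq_zero (n k : ℕ) : defect n k = 0 := by
  induction n generalizing k with
  | zero => exact defect_zero k
  | succ n ih =>
    have step (k : ℕ) : defect (n + 1) k = defect (n + 1) (k + 1) := by
      cases k with
      | zero => simpa [ih] using defect_succ_zero n
      | succ k => simpa [ih] using defect_succ_succ n k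
    have shift (m : ℕ) : defect (n + 1) k = defect (n + 1) (k + m) := by
      induction m with
      | zero => rfl
      | succ m hm => rw [hm, step, add_assoc]
    rw [shift (n + 3), defect_eq_zero_of_lt (by omega)]

lemma area_succ_zero_eq (n : ℕ) : area (n + 1) 0 = 3 * area n 0 + count (n + 1) 2 := by
  have := defect_eq_zero n 0
  simp only [defect] at this
  push_cast at this
  norm_num at this
  omega

lemma area_div_eq_sum (n : ℕ) :
    (area n 0 : ℝ) / 3 ^ n = ∑ m ∈ Finset.range (n + 1), (count m 2 : ℝ) / 3 ^ m := by
  induction n with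
  | zero => simp [area_zero, count_eq_zero]
  | succ n ih =>
    rw [Finset.sum_range_succ, ← ih, area_succ_zero_eq]
    push_cast
    rw [pow_succ]
    field_simp

/-- Weights satisfying the mean value property for the step operator, away from height `0`. -/
def weight (k : ℕ) : ℕ := 2 ^ k + if k = 0 then 1 else 0

lemma sum_weight_range (j : ℕ) :
    (∑ k ∈ Finset.range j, weight k) + 1 = 2 ^ j + if j = 0 then 0 else 1 := by
  induction j with
  | zero => simp
  | succ j ih =>
    rw [Finset.sum_range_succ, add_right_comm, ih, weight, pow_succ]
    grind

/-- The weighted number of Deutsch paths of length `n`. -/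
def weightedCount (n : ℕ) : ℕ := ∑ k ∈ Finset.range (n + 1), count n k * weight k

lemma sum_weight_successors {n j : ℕ} (hj : j ≤ n) :
    (∑ k ∈ Finset.range (n + 2), if k = j + 1 ∨ k < j then weight k else 0) +
      (if j = 0 then 4 else 0) = 3 * weight j := by
  have h : ({k ∈ Finset.range (n + 2) | k = j + 1 ∨ k < j} : Finset ℕ) =
      insert (j + 1) (Finset.range j) := by
    ext k
    simp only [Finset.mem_filter, Finset.mem_range, Finset.mem_insert]
    omega
  have := sum_weight_range j
  rw [← Finset.sum_filter, h, Finset.sum_insert (by simp)]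
  simp only [weight, pow_succ] at *
  grind

lemma weightedCount_succ (n : ℕ) :
    weightedCount (n + 1) + 4 * count n 0 = 3 * weightedCount n := by
  have h : weightedCount (n + 1) = ∑ j ∈ Finset.range (n + 1), count n j *
      ∑ k ∈ Finset.range (n + 2), if k = j + 1 ∨ k < j then weight k else 0 := by
    simp only [weightedCount, count_succ, predecessors, Finset.sum_filter, Finset.sum_mul,
      Finset.mul_sum]
    rw [Finset.sum_comm]
    simp
  rw [h, eq_sum_ite (φ := count n) (fun k => count_eq_zero) 0, Finset.mul_sum,
    ← Finset.sum_add_distrib, weightedCount, Finset.mul_sum]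
  refine Finset.sum_congr rfl fun j hj => ?_
  rw [mul_left_comm, ← sum_weight_successors (Nat.lt_succ_iff.1 (Finset.mem_range.1 hj))]
  split_ifs <;> ring

lemma sum_count_zero_add (n : ℕ) :
    (∑ m ∈ Finset.range n, (count m 0 : ℝ) / 3 ^ m) + 3 / 4 * weightedCount n / 3 ^ n =
      3 / 2 := by
  induction n with
  | zero => norm_num [weightedCount, count_zero_zero, weight]
  | succ n ih =>
    have h : (weightedCount (n + 1) : ℝ) = 3 * weightedCount n - 4 * count n 0 := by
      rw [eq_sub_iff_add_eq]
      exact_mod_cast weightedCount_succ n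
    rw [Finset.sum_range_succ, ← ih, h, pow_succ]
    field_simp
    ring

lemma sum_count_zero_le (n : ℕ) :
    ∑ m ∈ Finset.range n, (count m 0 : ℝ) / 3 ^ m ≤ 3 / 2 := by
  rw [← sum_count_zero_add n]
  exact le_add_of_nonneg_right (by positivity)

lemma count_le_count_zero (n k : ℕ) : count n (k + 1) ≤ count (n + 1) 0 := by
  rcases lt_or_ge n (k + 1) with h | h
  · simp [count_eq_zero h]
  · rw [count_succ]
    refine Finset.single_le_sum (f := count n) (fun _ _ => Nat.zero_le _) ?_
    simp [predecessors]
    omega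

lemma summable_count (k : ℕ) : Summable fun n => (count n k : ℝ) / 3 ^ n := by
  have h0 : Summable fun n => (count n 0 : ℝ) / 3 ^ n :=
    summable_of_sum_range_le (fun _ => by positivity) sum_count_zero_le
  cases k with
  | zero => exact h0
  | succ k =>
    refine Summable.of_nonneg_of_le (fun _ => by positivity) (fun n => ?_)
      (((summable_nat_add_iff 1).2 h0).mul_left 3)
    have : (count n (k + 1) : ℝ) ≤ count (n + 1) 0 := mod_cast count_le_count_zero n k
    rw [pow_succ]
    field_simp
    exact this

/-- The generating function at `1 / 3` of the Deutsch paths ending at height `k`. -/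
noncomputable def series (k : ℕ) : ℝ := ∑' n, (count n k : ℝ) / 3 ^ n

lemma hasSum_series (k : ℕ) : HasSum (fun n => (count n k : ℝ) / 3 ^ n) (series k) :=
  (summable_count k).hasSum

lemma hasSum_succ (k : ℕ) :
    HasSum (fun n => (count (n + 1) k : ℝ) / 3 ^ n) (3 * (series k - count 0 k)) := by
  have h := ((hasSum_nat_add_iff' 1).2 (hasSum_series k)).mul_left 3
  simp only [Finset.sum_range_one, pow_zero, div_one] at h
  refine h.congr_fun fun n => ?_
  rw [pow_succ]
  field_simp

lemma series_one : series 1 = series 0 - 3 / 4 := by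
  have h := ((hasSum_succ 0).add (hasSum_series 0)).unique
    (f := fun n => (count (n + 1) 0 : ℝ) / 3 ^ n + (count n 0 : ℝ) / 3 ^ n)
    (a₂ := 3 * (series 1 - count 0 1) + series 1) (by
      convert (hasSum_succ 1).add (hasSum_series 1) using 2 with n
      rw [← add_div, ← add_div]
      congr 1
      exact_mod_cast count_succ_zero n)
  rw [count_zero_zero, count_eq_zero one_pos] at h
  push_cast at h
  linarith

lemma series_add_two (k : ℕ) : series (k + 2) = series (k + 1) - series k / 4 := by
  have h := ((hasSum_succ (k + 1)).add (hasSum_series (k + 1))).unique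
    (f := fun n => (count (n + 1) (k + 1) : ℝ) / 3 ^ n + (count n (k + 1) : ℝ) / 3 ^ n)
    (a₂ := 3 * (series (k + 2) - count 0 (k + 2)) + series k + series (k + 2)) (by
      convert ((hasSum_succ (k + 2)).add (hasSum_series k)).add
        (hasSum_series (k + 2)) using 2 with n
      rw [← add_div, ← add_div, ← add_div]
      congr 1
      exact_mod_cast count_succ_succ n k)
  rw [count_eq_zero (Nat.succ_pos _), count_eq_zero (Nat.succ_pos _)] at h
  push_cast at h
  linarith

lemma series_eq (k : ℕ) :
    series k = (series 0 + k * (series 0 - 3 / 2)) / 2 ^ k := by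
  induction k using Nat.twoStepInduction with
  | zero => simp
  | one => rw [series_one]; norm_num; ring
  | more k h₁ h₂ =>
    rw [series_add_two, h₂, h₁]
    field_simp
    push_cast
    ring

lemma series_zero : series 0 = 3 / 2 := by
  refine le_antisymm
    (Real.tsum_le_of_sum_range_le (fun _ => by positivity) sum_count_zero_le) ?_
  by_contra! h
  obtain ⟨k, hk⟩ := exists_nat_gt (series 0 / (3 / 2 - series 0))
  have hneg : series k < 0 := by
    rw [div_lt_iff₀ (by linarith)] at hk
    rw [series_eq]
    exact div_neg_of_neg_of_pos (by linarith) (by positivity)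
  exact hneg.not_ge (tsum_nonneg fun _ => by positivity)

lemma series_two : series 2 = 3 / 8 := by
  rw [series_eq, series_zero]
  norm_num

end DeutschPath

theorem total_area_asymptotics :
    Tendsto (fun n : ℕ => (A n : ℝ) / 3 ^ n) atTop (nhds (3 / 8)) := by
  have h := (DeutschPath.hasSum_series 2).tendsto_sum_nat.comp (tendsto_add_atTop_nat 1)
  rw [DeutschPath.series_two] at h
  refine h.congr fun n => ?_
  rw [DeutschPath.A_eq_area, DeutschPath.area_div_eq_sum, Function.comp_apply]
end
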